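/- Let d ≥ 2. A traceless Hermitian matrix Δ on C^d ⊗ C^d has the property that ρ + λΔ is a classical-quantum state for every classical-quantum state ρ and every real number λ such that ρ + λΔ is positive semidefinite, if and only if Δ = I ⊗ Ξ for some traceless Hermitian d×d matrix Ξ. -/

import Mathlib

open Matrix
open Kronecker
open scoped ComplexOrder

noncomputable section

/-- A state (density matrix): positive semidefinite with trace 1. -/
def IsState {n : Type*} [Fintype n] (ρ : Matrix n n ℂ) : Prop :=
  ρ.PosSemidef ∧ ρ.trace = 1

/-- A family of `d` vectors in `ℂ^d` forming an orthonormal basis. -/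
def IsONB {d : ℕ} (φ : Fin d → Fin d → ℂ) : Prop :=
  ∀ i j, star (φ i) ⬝ᵥ φ j = if i = j then 1 else 0

/-- Classical-quantum states: `ρ = ∑ᵢ cᵢ |φᵢ⟩⟨φᵢ| ⊗ ηᵢ` for an orthonormal basis `{φᵢ}`,
nonnegative `cᵢ` summing to `1`, and states `ηᵢ`. -/
def IsCQ {d : ℕ} (ρ : Matrix (Fin d × Fin d) (Fin d × Fin d) ℂ) : Prop :=
  ∃ (φ : Fin d → Fin d → ℂ) (c : Fin d → ℝ) (η : Fin d → Matrix (Fin d) (Fin d) ℂ),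
    IsONB φ ∧ (∀ i, 0 ≤ c i) ∧ ((∑ i, c i) = 1) ∧ (∀ i, IsState (η i)) ∧
    ρ = ∑ i, (c i : ℂ) • (vecMulVec (φ i) (star (φ i)) ⊗ₖ η i)

/-- Quantum-classical states: `ρ = ∑ᵢ cᵢ σᵢ ⊗ |χᵢ⟩⟨χᵢ|`. -/
def IsQC {d : ℕ} (ρ : Matrix (Fin d × Fin d) (Fin d × Fin d) ℂ) : Prop :=
  ∃ (χ : Fin d → Fin d → ℂ) (c : Fin d → ℝ) (σ : Fin d → Matrix (Fin d) (Fin d) ℂ),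
    IsONB χ ∧ (∀ i, 0 ≤ c i) ∧ ((∑ i, c i) = 1) ∧ (∀ i, IsState (σ i)) ∧
    ρ = ∑ i, (c i : ℂ) • (σ i ⊗ₖ vecMulVec (χ i) (star (χ i)))

/-- Classical-classical states: `ρ = ∑ᵢⱼ cᵢⱼ |φᵢ⟩⟨φᵢ| ⊗ |χⱼ⟩⟨χⱼ|`. -/
def IsCC {d : ℕ} (ρ : Matrix (Fin d × Fin d) (Fin d × Fin d) ℂ) : Prop :=
  ∃ (φ χ : Fin d → Fin d → ℂ) (c : Fin d → Fin d → ℝ),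
    IsONB φ ∧ IsONB χ ∧ (∀ i j, 0 ≤ c i j) ∧ ((∑ i, ∑ j, c i j) = 1) ∧
    ρ = ∑ i, ∑ j, (c i j : ℂ) • (vecMulVec (φ i) (star (φ i)) ⊗ₖ vecMulVec (χ j) (star (χ j)))

/-- The column matrix of an orthonormal basis is unitary. -/
theorem IsONB.conjTranspose_mul_self {d : ℕ} {φ : Fin d → Fin d → ℂ} (h : IsONB φ) :
    (Matrix.of φ)ᵀᴴ * (Matrix.of φ)ᵀ = 1 := by
  ext i j
  simpa [Matrix.mul_apply, dotProduct, Matrix.one_apply] using h i j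

/-- Resolution of the identity by an orthonormal basis. -/
theorem IsONB.sum_vecMulVec {d : ℕ} {φ : Fin d → Fin d → ℂ} (h : IsONB φ) :
    ∑ i, vecMulVec (φ i) (star (φ i)) = 1 := by
  rw [← mul_eq_one_comm.mp h.conjTranspose_mul_self]
  ext i j
  simp [Matrix.sum_apply, Matrix.mul_apply, vecMulVec_apply]

/-- A block-diagonal matrix with respect to an orthonormal basis of the first factor, with positive
semidefinite blocks and trace one, is classical-quantum. -/
theorem isCQ_sum_kronecker {d : ℕ} (hd : 0 < d) {φ : Fin d → Fin d → ℂ} (h : IsONB φ)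
    {M : Fin d → Matrix (Fin d) (Fin d) ℂ} (hM : ∀ i, (M i).PosSemidef)
    (htr : ∑ i, (M i).trace = 1) :
    IsCQ (∑ i, vecMulVec (φ i) (star (φ i)) ⊗ₖ M i) := by
  have hre : ∀ i, (((M i).trace.re : ℝ) : ℂ) = (M i).trace := fun i =>
    (Complex.eq_re_of_ofReal_le (r := 0) (Complex.ofReal_zero ▸ (hM i).trace_nonneg)).symm
  have hpos : ∀ i, 0 ≤ (M i).trace.re := fun i =>
    (Complex.le_def.mp (hM i).trace_nonneg).1
  have key : ∀ i, ∃ η : Matrix (Fin d) (Fin d) ℂ, IsState η ∧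
      M i = ((M i).trace.re : ℂ) • η := by
    intro i
    by_cases h0 : (M i).trace = 0
    · refine ⟨single ⟨0, hd⟩ ⟨0, hd⟩ 1, ⟨?_, by simp⟩, ?_⟩
      · rw [← diagonal_single]
        refine PosSemidef.diagonal ?_
        intro j
        by_cases hj : j = ⟨0, hd⟩ <;> simp [hj]
      · rw [hre, h0, zero_smul]
        exact (hM i).trace_eq_zero_iff.mp h0
    · refine ⟨((M i).trace.re : ℂ)⁻¹ • M i, ⟨(hM i).smul ?_, ?_⟩, ?_⟩
      · rw [← Complex.ofReal_inv]
        exact_mod_cast inv_nonneg.mpr (hpos i)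
      · rw [trace_smul, hre, smul_eq_mul, inv_mul_cancel₀ h0]
      · rw [hre, smul_smul, mul_inv_cancel₀ h0, one_smul]
  choose η hη hMη using key
  refine ⟨φ, fun i => (M i).trace.re, η, h, hpos, ?_, hη, ?_⟩
  · have := congrArg Complex.re htr
    simpa using this
  · refine Finset.sum_congr rfl fun i _ => ?_
    rw [← kronecker_smul, ← hMη]

/-- The diagonal blocks of a positive semidefinite block-diagonal matrix are positive
semidefinite. -/
theorem posSemidef_block {d : ℕ} {φ : Fin d → Fin d → ℂ} (h : IsONB φ)
    {M : Fin d → Matrix (Fin d) (Fin d) ℂ}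
    (hM : (∑ i, vecMulVec (φ i) (star (φ i)) ⊗ₖ M i).PosSemidef) (i : Fin d) :
    (M i).PosSemidef := by
  let U : Matrix (Fin d) (Fin d) ℂ := (Matrix.of φ)ᵀ
  have hφ : ∀ j, Uᴴ *ᵥ φ j = Pi.single j 1 := by
    intro j
    ext k
    have := h k j
    simpa [U, mulVec, dotProduct, Pi.single_apply] using this
  have hφ' : ∀ j, star (φ j) ᵥ* U = Pi.single j 1 := by
    intro j
    have := congrArg star (hφ j)
    rwa [star_mulVec, conjTranspose_conjTranspose, Pi.star_single, star_one] at this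
  have h1 := (hM.conjTranspose_mul_mul_same (U ⊗ₖ (1 : Matrix (Fin d) (Fin d) ℂ))).submatrix
    (fun k : Fin d => (i, k))
  convert h1 using 1
  rw [conjTranspose_kronecker, conjTranspose_one, Matrix.mul_sum, Matrix.sum_mul]
  simp_rw [← mul_kronecker_mul, one_mul, mul_one, mul_vecMulVec, vecMulVec_mul, hφ, hφ']
  ext k l
  simp [Matrix.sum_apply, vecMulVec_apply, Pi.single_apply]

/-- The blocks of a classical-quantum state, as operators on the first factor, commute. -/
theorem IsCQ.commute_blocks {d : ℕ} {ρ : Matrix (Fin d × Fin d) (Fin d × Fin d) ℂ} (h : IsCQ ρ)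
    (k l m n : Fin d) :
    Commute (ρ.submatrix (fun i => (i, k)) (fun i => (i, l)))
      (ρ.submatrix (fun i => (i, m)) (fun i => (i, n))) := by
  obtain ⟨φ, c, η, hφ, -, -, -, rfl⟩ := h
  have key : ∀ k l : Fin d,
      (∑ i, (c i : ℂ) • (vecMulVec (φ i) (star (φ i)) ⊗ₖ η i)).submatrix
        (fun i => (i, k)) (fun i => (i, l)) =
      ∑ i, ((c i : ℂ) * η i k l) • vecMulVec (φ i) (star (φ i)) := by
    intro k l
    ext a b
    simp only [submatrix_apply, Matrix.sum_apply, Matrix.smul_apply, kroneckerMap_apply,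
      smul_eq_mul]
    exact Finset.sum_congr rfl fun i _ => by ring
  rw [key, key]
  refine Commute.sum_left _ _ _ fun i _ => Commute.sum_right _ _ _ fun j _ => ?_
  refine Commute.smul_left (Commute.smul_right ?_ _) _
  by_cases hij : i = j
  · rw [hij]
    exact Commute.refl _
  · have h1 := hφ i j
    have h2 := hφ j i
    rw [if_neg hij] at h1
    rw [if_neg (Ne.symm hij)] at h2
    simp [Commute, SemiconjBy, vecMulVec_mul_vecMulVec, h1, h2]

/-- A small Hermitian perturbation of the identity is positive semidefinite. -/
theorem exists_pos_posSemidef_one_add_smul {n : Type*} [Fintype n] [DecidableEq n]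
    {A : Matrix n n ℂ} (hA : A.IsHermitian) :
    ∃ ε : ℝ, 0 < ε ∧ (1 + (ε : ℂ) • A).PosSemidef := by
  let C : ℝ := 1 + ∑ i, |hA.eigenvalues i|
  have hsum : 0 ≤ ∑ i, |hA.eigenvalues i| := Finset.sum_nonneg fun i _ => abs_nonneg _
  have hC : 0 < C := by positivity
  refine ⟨C⁻¹, inv_pos.mpr hC, ?_⟩
  let U : Matrix n n ℂ := hA.eigenvectorUnitary
  have hU : U * Uᴴ = 1 := Unitary.coe_mul_star_self hA.eigenvectorUnitary
  have hspec : A = U * diagonal (fun i => (hA.eigenvalues i : ℂ)) * Uᴴ := hA.spectral_theorem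
  have hD : (diagonal (fun i => ((1 + C⁻¹ * hA.eigenvalues i : ℝ) : ℂ))).PosSemidef := by
    refine PosSemidef.diagonal fun i => ?_
    have h1 : |hA.eigenvalues i| ≤ C := by
      have := Finset.single_le_sum (fun j _ => abs_nonneg (hA.eigenvalues j)) (Finset.mem_univ i)
      simp only [C]
      linarith
    have h2 : 0 ≤ 1 + C⁻¹ * hA.eigenvalues i := by
      have h3 := neg_le_of_abs_le h1
      have h4 : 1 + C⁻¹ * hA.eigenvalues i = C⁻¹ * (C + hA.eigenvalues i) := by
        field_simp
      rw [h4]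
      exact mul_nonneg (inv_pos.mpr hC).le (by linarith)
    simpa using (Complex.zero_le_real.mpr h2)
  have h5 := hD.mul_mul_conjTranspose_same U
  convert h5 using 1
  have h6 : diagonal (fun i => ((1 + C⁻¹ * hA.eigenvalues i : ℝ) : ℂ)) =
      1 + ((C⁻¹ : ℝ) : ℂ) • diagonal (fun i => (hA.eigenvalues i : ℂ)) := by
    ext i j
    by_cases hij : i = j <;> simp [hij]
  rw [h6, mul_add, add_mul, mul_one, hU, Matrix.mul_smul, Matrix.smul_mul, ← hspec]

/-- Adding a positive product operator to the identity gives, after normalization, a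
classical-quantum state. -/
theorem exists_isCQ_smul_one_add_kronecker {d : ℕ} (hd : 0 < d) {K L : Matrix (Fin d) (Fin d) ℂ}
    (hK : K.PosSemidef) (hL : L.PosSemidef) :
    ∃ t : ℝ, 0 < t ∧ IsCQ ((t : ℂ) • (1 + K ⊗ₖ L)) := by
  let φ : Fin d → Fin d → ℂ := fun i a => (hK.isHermitian.eigenvectorUnitary : Matrix _ _ ℂ) a i
  have hφ : IsONB φ := by
    intro i j
    have h1 : (hK.isHermitian.eigenvectorUnitary : Matrix (Fin d) (Fin d) ℂ)ᴴ *
        (hK.isHermitian.eigenvectorUnitary : Matrix (Fin d) (Fin d) ℂ) = 1 :=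
      Unitary.coe_star_mul_self hK.isHermitian.eigenvectorUnitary
    have h2 := congrFun (congrFun h1 i) j
    simpa [φ, dotProduct, Matrix.mul_apply, Matrix.one_apply] using h2
  let e := hK.isHermitian.eigenvalues
  have he : ∀ i, (0 : ℂ) ≤ e i := fun i => Complex.zero_le_real.mpr (hK.eigenvalues_nonneg i)
  have hspec : K = ∑ i, (e i : ℂ) • vecMulVec (φ i) (star (φ i)) := by
    have h1 : K = (hK.isHermitian.eigenvectorUnitary : Matrix _ _ ℂ) *
        diagonal (fun i => (e i : ℂ)) * (hK.isHermitian.eigenvectorUnitary : Matrix _ _ ℂ)ᴴ :=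
      hK.isHermitian.spectral_theorem
    ext a b
    have h2 := congrFun (congrFun h1 a) b
    rw [h2, Matrix.mul_apply]
    simp only [mul_diagonal, Matrix.sum_apply, Matrix.smul_apply, vecMulVec_apply,
      conjTranspose_apply, Pi.star_apply, smul_eq_mul, φ]
    exact Finset.sum_congr rfl fun i _ => by ring
  have hps : (1 + K ⊗ₖ L).PosSemidef := PosSemidef.one.add (hK.kronecker hL)
  have htr : (0 : ℝ) < (1 + K ⊗ₖ L).trace.re := by
    have h1 := (Complex.le_def.mp (hK.kronecker hL).trace_nonneg).1
    have hd' : (0 : ℝ) < d := by exact_mod_cast hd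
    have h2 : (0 : ℝ) < d * d := by positivity
    simp only [trace_add, trace_one, Fintype.card_prod, Fintype.card_fin, Complex.add_re]
    simp only [Complex.zero_re] at h1
    have h3 : (((d * d : ℕ) : ℂ)).re = d * d := by
      rw [Complex.natCast_re]; push_cast; rfl
    rw [h3]
    linarith
  have hre : (((1 + K ⊗ₖ L).trace.re : ℝ) : ℂ) = (1 + K ⊗ₖ L).trace :=
    (Complex.eq_re_of_ofReal_le (r := 0) (Complex.ofReal_zero ▸ hps.trace_nonneg)).symm
  set T : ℝ := (1 + K ⊗ₖ L).trace.re with hT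
  have hT0 : (0 : ℂ) ≤ ((T⁻¹ : ℝ) : ℂ) := Complex.zero_le_real.mpr (inv_pos.mpr htr).le
  have hdec : ((T⁻¹ : ℝ) : ℂ) • (1 + K ⊗ₖ L) = ∑ i, vecMulVec (φ i) (star (φ i)) ⊗ₖ
      (((T⁻¹ : ℝ) : ℂ) • (1 + (e i : ℂ) • L)) := by
    have h1 : (1 : Matrix (Fin d × Fin d) (Fin d × Fin d) ℂ) =
        (∑ i, vecMulVec (φ i) (star (φ i))) ⊗ₖ (1 : Matrix (Fin d) (Fin d) ℂ) := by
      rw [hφ.sum_vecMulVec, one_kronecker_one]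
    conv_lhs => rw [h1, hspec]
    ext ⟨a, k⟩ ⟨b, l⟩
    simp only [Matrix.smul_apply, Matrix.add_apply, kroneckerMap_apply, Matrix.sum_apply,
      smul_eq_mul, Finset.sum_mul, Finset.mul_sum, ← Finset.sum_add_distrib]
    exact Finset.sum_congr rfl fun i _ => by ring
  refine ⟨T⁻¹, inv_pos.mpr htr, ?_⟩
  have htr1 : (((T⁻¹ : ℝ) : ℂ) • (1 + K ⊗ₖ L)).trace = 1 := by
    rw [trace_smul, ← hre, smul_eq_mul, ← Complex.ofReal_mul, inv_mul_cancel₀ htr.ne',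
      Complex.ofReal_one]
  rw [hdec] at htr1 ⊢
  refine isCQ_sum_kronecker hd hφ (fun i => (PosSemidef.one.add (hL.smul (he i))).smul hT0) ?_
  rw [trace_sum] at htr1
  rw [← htr1]
  refine Finset.sum_congr rfl fun i _ => ?_
  have h1 : (vecMulVec (φ i) (star (φ i))).trace = 1 := by
    rw [trace_vecMulVec, dotProduct_comm, hφ i i, if_pos rfl]
  rw [trace_kronecker, h1, one_mul]

/-- A matrix commuting with every rank-one positive operator is scalar. -/
theorem eq_smul_one_of_commute_vecMulVec {n : Type*} [Fintype n] [DecidableEq n] (i₀ : n)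
    {A : Matrix n n ℂ} (h : ∀ v : n → ℂ, Commute (vecMulVec v (star v)) A) :
    A = A i₀ i₀ • (1 : Matrix n n ℂ) := by
  have hoff : ∀ i j, i ≠ j → A i j = 0 := by
    intro i j hij
    have h1 := congrFun (congrFun (h (Pi.single i 1)).eq i) j
    simpa [vecMulVec_mul, mul_vecMulVec, vecMulVec_apply, Pi.star_single, hij.symm, hij] using h1
  have hdiag : ∀ i, A i i = A i₀ i₀ := by
    intro i
    by_cases hi : i = i₀
    · rw [hi]
    have h1 := congrFun (congrFun (h (Pi.single i 1 + Pi.single i₀ 1)).eq i) i₀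
    simpa [vecMulVec_mul, mul_vecMulVec, vecMulVec_apply, Pi.star_single, star_add, add_vecMul,
      mulVec_add, hoff i i₀ hi, hi, Ne.symm hi] using h1.symm
  ext i j
  by_cases hij : i = j
  · subst hij
    simp [hdiag i]
  · simp [hij, hoff i j hij]

/-- If a Hermitian `Δ` preserves classical-quantum states, its blocks commute with every positive
semidefinite operator on the first factor. -/
theorem commute_block_of_preserves {d : ℕ} (hd : 2 ≤ d)
    {Δ : Matrix (Fin d × Fin d) (Fin d × Fin d) ℂ} (hΔH : Δ.IsHermitian)
    (h : ∀ (ρ : Matrix (Fin d × Fin d) (Fin d × Fin d) ℂ) (lam : ℝ),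
        IsCQ ρ → (ρ + (lam : ℂ) • Δ).PosSemidef → IsCQ (ρ + (lam : ℂ) • Δ))
    {K : Matrix (Fin d) (Fin d) ℂ} (hK : K.PosSemidef) (m n : Fin d) :
    Commute K (Δ.submatrix (fun i => (i, m)) (fun i => (i, n))) := by
  obtain ⟨ε, hε, hεΔ⟩ := exists_pos_posSemidef_one_add_smul hΔH
  have hε0 : (ε : ℂ) ≠ 0 := by exact_mod_cast hε.ne'
  let B : Fin d → Fin d → Matrix (Fin d) (Fin d) ℂ :=
    fun k l => Δ.submatrix (fun i => (i, k)) (fun i => (i, l))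
  have main : ∀ {K L : Matrix (Fin d) (Fin d) ℂ}, K.PosSemidef → L.PosSemidef →
      ∀ k l m n, Commute
        ((1 : Matrix (Fin d) (Fin d) ℂ) k l • (1 : Matrix (Fin d) (Fin d) ℂ) + L k l • K +
          (ε : ℂ) • B k l)
        ((1 : Matrix (Fin d) (Fin d) ℂ) m n • (1 : Matrix (Fin d) (Fin d) ℂ) + L m n • K +
          (ε : ℂ) • B m n) := by
    intro K L hK hL k l m n
    obtain ⟨t, ht, hCQ⟩ := exists_isCQ_smul_one_add_kronecker (by omega) hK hL
    have ht0 : (t : ℂ) ≠ 0 := by exact_mod_cast ht.ne'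
    have heq : (t : ℂ) • (1 + K ⊗ₖ L) + ((t * ε : ℝ) : ℂ) • Δ =
        (t : ℂ) • ((1 + (ε : ℂ) • Δ) + K ⊗ₖ L) := by
      rw [Complex.ofReal_mul, mul_smul, ← smul_add]
      congr 1
      abel
    have hps : ((t : ℂ) • (1 + K ⊗ₖ L) + ((t * ε : ℝ) : ℂ) • Δ).PosSemidef := by
      rw [heq]
      exact (hεΔ.add (hK.kronecker hL)).smul (Complex.zero_le_real.mpr ht.le)
    have hc := (h _ _ hCQ hps).commute_blocks k l m n
    rw [heq] at hc
    have hblock : ∀ k l : Fin d, ((t : ℂ) • ((1 + (ε : ℂ) • Δ) + K ⊗ₖ L)).submatrix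
        (fun i => (i, k)) (fun i => (i, l)) = (t : ℂ) •
        ((1 : Matrix (Fin d) (Fin d) ℂ) k l • (1 : Matrix (Fin d) (Fin d) ℂ) + L k l • K +
          (ε : ℂ) • B k l) := by
      intro k l
      have h1 : (1 : Matrix (Fin d × Fin d) (Fin d × Fin d) ℂ) =
          (1 : Matrix (Fin d) (Fin d) ℂ) ⊗ₖ (1 : Matrix (Fin d) (Fin d) ℂ) :=
        one_kronecker_one.symm
      rw [h1]
      ext a b
      simp only [submatrix_apply, Matrix.smul_apply, Matrix.add_apply, kroneckerMap_apply,
        smul_eq_mul, B]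
      ring
    rw [hblock, hblock] at hc
    exact (Commute.smul_left_iff₀ ht0).mp ((Commute.smul_right_iff₀ ht0).mp hc)
  have cancel : ∀ (a b : ℂ) (X Y : Matrix (Fin d) (Fin d) ℂ),
      Commute (a • (1 : Matrix (Fin d) (Fin d) ℂ) + X)
        (b • (1 : Matrix (Fin d) (Fin d) ℂ) + Y) → Commute X Y := by
    intro a b X Y hXY
    have h1 : ∀ (c : ℂ) (Z : Matrix (Fin d) (Fin d) ℂ),
        Commute (c • (1 : Matrix (Fin d) (Fin d) ℂ)) Z := fun c Z =>
      (Commute.one_left Z).smul_left c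
    have h2 := hXY.sub_left (h1 a _)
    rw [add_sub_cancel_left] at h2
    have h3 := h2.sub_right (h1 b X).symm
    rwa [add_sub_cancel_left] at h3
  have hB : ∀ k l m n, Commute (B k l) (B m n) := by
    intro k l m n
    have h1 := main (PosSemidef.zero (n := Fin d)) (PosSemidef.zero (n := Fin d)) k l m n
    simp only [smul_zero, add_zero] at h1
    exact (Commute.smul_left_iff₀ hε0).mp ((Commute.smul_right_iff₀ hε0).mp (cancel _ _ _ _ h1))
  obtain ⟨p, hp⟩ : ∃ p : Fin d, p ≠ m := by
    have : Nontrivial (Fin d) := Fin.nontrivial_iff_two_le.mpr hd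
    exact exists_ne m
  have hL : (single p p (1 : ℂ)).PosSemidef := by
    rw [← diagonal_single]
    refine PosSemidef.diagonal fun j => ?_
    by_cases hj : j = p <;> simp [hj]
  have h1 := main hK hL p p m n
  rw [single_apply_same, single_apply_of_row_ne hp, zero_smul, add_zero, one_smul, add_assoc] at h1
  have h2 := (Commute.smul_right_iff₀ hε0).mp (cancel _ _ _ _ h1)
  have h3 := h2.sub_left ((hB p p m n).smul_left (ε : ℂ))
  rwa [add_sub_cancel_right] at h3

theorem stmt15 (d : ℕ) (hd : 2 ≤ d)
    (Δ : Matrix (Fin d × Fin d) (Fin d × Fin d) ℂ)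
    (hΔH : Δ.IsHermitian) (hΔtr : Δ.trace = 0) :
    (∀ (ρ : Matrix (Fin d × Fin d) (Fin d × Fin d) ℂ) (lam : ℝ),
        IsCQ ρ → (ρ + (lam : ℂ) • Δ).PosSemidef → IsCQ (ρ + (lam : ℂ) • Δ)) ↔
      ∃ Ξ : Matrix (Fin d) (Fin d) ℂ, Ξ.IsHermitian ∧ Ξ.trace = 0 ∧
        Δ = (1 : Matrix (Fin d) (Fin d) ℂ) ⊗ₖ Ξ := by
  constructor
  · intro h
    let i₀ : Fin d := ⟨0, by omega⟩
    have hΔ : Δ = (1 : Matrix (Fin d) (Fin d) ℂ) ⊗ₖ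
        Δ.submatrix (fun k => (i₀, k)) (fun k => (i₀, k)) := by
      ext ⟨a, k⟩ ⟨b, l⟩
      have h1 := eq_smul_one_of_commute_vecMulVec i₀ fun v =>
        commute_block_of_preserves hd hΔH h (posSemidef_vecMulVec_self_star v) k l
      have h2 := congrFun (congrFun h1 a) b
      simp only [submatrix_apply, Matrix.smul_apply, smul_eq_mul] at h2
      rw [h2, kroneckerMap_apply, submatrix_apply, mul_comm]
    refine ⟨_, hΔH.submatrix _, ?_, hΔ⟩
    rw [hΔ, trace_kronecker, trace_one, Fintype.card_fin] at hΔtr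
    refine (mul_eq_zero.mp hΔtr).resolve_left ?_
    exact_mod_cast (by omega : d ≠ 0)
  · rintro ⟨Ξ, -, hΞtr, rfl⟩ ρ lam ⟨φ, c, η, hφ, -, hc1, hη, rfl⟩ hps
    have heq : ∑ i, (c i : ℂ) • (vecMulVec (φ i) (star (φ i)) ⊗ₖ η i) +
        (lam : ℂ) • ((1 : Matrix (Fin d) (Fin d) ℂ) ⊗ₖ Ξ) =
        ∑ i, vecMulVec (φ i) (star (φ i)) ⊗ₖ ((c i : ℂ) • η i + (lam : ℂ) • Ξ) := by
      rw [← hφ.sum_vecMulVec]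
      ext ⟨a, k⟩ ⟨b, l⟩
      simp only [Matrix.smul_apply, Matrix.add_apply, kroneckerMap_apply, Matrix.sum_apply,
        smul_eq_mul, Finset.sum_mul, Finset.mul_sum, ← Finset.sum_add_distrib]
      exact Finset.sum_congr rfl fun i _ => by ring
    rw [heq] at hps ⊢
    refine isCQ_sum_kronecker (by omega) hφ (posSemidef_block hφ hps) ?_
    simp only [trace_add, trace_smul, hΞtr, (hη _).2, smul_eq_mul, mul_one, mul_zero, add_zero]
    exact_mod_cast hc1
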